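/- Let μ be a Borel probability measure on ℝ^d whose moment generating function is finite everywhere, i.e. ∫_{ℝ^d} exp⟨α, z⟩ dμ(z) < ∞ for every α ∈ ℝ^d. Then the Lagrangian is superlinear: L(β)/‖β‖ → ∞ as ‖β‖ → ∞; equivalently, for every M > 0 there exists R > 0 such that L(β) ≥ M‖β‖ for all β with ‖β‖ ≥ R. -/

import Mathlib

open MeasureTheory

/-- If the moment generating function of a Borel probability measure `μ` on
`ℝ^d` is finite everywhere, then the Lagrangian `L(β) = sup_α (⟪α, β⟫ - H(α))`, where
`H(α) = log ∫ exp⟪α, z⟫ dμ(z)`, is superlinear: for every `M > 0` there exists `R > 0`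
such that `L(β) ≥ M‖β‖` whenever `‖β‖ ≥ R`. -/
theorem lagrangian_superlinear (d : ℕ)
    (μ : Measure (EuclideanSpace ℝ (Fin d))) [IsProbabilityMeasure μ]
    (hmgf : ∀ α : EuclideanSpace ℝ (Fin d),
      Integrable (fun z => Real.exp (inner ℝ α z : ℝ)) μ)
    (H : EuclideanSpace ℝ (Fin d) → ℝ)
    (hH : ∀ α, H α = Real.log (∫ z, Real.exp (inner ℝ α z : ℝ) ∂μ))
    (L : EuclideanSpace ℝ (Fin d) → EReal)
    (hL : ∀ β, L β = ⨆ α, (((inner ℝ α β : ℝ) - H α : ℝ) : EReal)) :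
    ∀ M > (0 : ℝ), ∃ R > (0 : ℝ), ∀ β : EuclideanSpace ℝ (Fin d),
      R ≤ ‖β‖ → ((M * ‖β‖ : ℝ) : EReal) ≤ L β := by
  intro M hM
  have hconv : ConvexOn ℝ Set.univ
      (fun α : EuclideanSpace ℝ (Fin d) => ∫ z, Real.exp (inner ℝ α z : ℝ) ∂μ) := by
    refine ⟨convex_univ, ?_⟩
    intro x _ y _ a b ha hb hab
    have hle : ∫ z, Real.exp (inner ℝ (a • x + b • y) z : ℝ) ∂μ ≤
        ∫ z, (a * Real.exp (inner ℝ x z : ℝ) + b * Real.exp (inner ℝ y z : ℝ)) ∂μ := by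
      refine integral_mono (hmgf _) (((hmgf x).const_mul a).add ((hmgf y).const_mul b)) ?_
      intro z
      have := convexOn_exp.2 (Set.mem_univ (inner ℝ x z : ℝ))
        (Set.mem_univ (inner ℝ y z : ℝ)) ha hb hab
      simpa [inner_add_left, real_inner_smul_left] using this
    rw [integral_add ((hmgf x).const_mul a) ((hmgf y).const_mul b),
      integral_const_mul, integral_const_mul] at hle
    simpa using hle
  have hcont : Continuous
      (fun α : EuclideanSpace ℝ (Fin d) => ∫ z, Real.exp (inner ℝ α z : ℝ) ∂μ) := by
    have h := hconv.continuousOn_interior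
    rw [interior_univ] at h
    exact continuousOn_univ.mp h
  obtain ⟨C, hC⟩ := (isCompact_closedBall (0 : EuclideanSpace ℝ (Fin d)) (M + 1)).bddAbove_image
    hcont.continuousOn
  refine ⟨max C 1, by positivity, ?_⟩
  intro β hβ
  have h1 : 1 ≤ ‖β‖ := le_trans (le_max_right _ _) hβ
  have h2 : C ≤ ‖β‖ := le_trans (le_max_left _ _) hβ
  have h0 : ‖β‖ ≠ 0 := by positivity
  rw [hL]
  refine le_trans ?_ (le_iSup _ (((M + 1) / ‖β‖) • β))
  rw [EReal.coe_le_coe_iff, real_inner_smul_left, real_inner_self_eq_norm_sq]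
  have e : (M + 1) / ‖β‖ * ‖β‖ ^ 2 = (M + 1) * ‖β‖ := by
    field_simp
  have hmem : ((M + 1) / ‖β‖) • β ∈
      Metric.closedBall (0 : EuclideanSpace ℝ (Fin d)) (M + 1) := by
    rw [mem_closedBall_zero_iff, norm_smul, Real.norm_of_nonneg (by positivity),
      div_mul_cancel₀ _ h0]
  have hZ := hC (Set.mem_image_of_mem _ hmem)
  have hlog : H (((M + 1) / ‖β‖) • β) ≤ C := by
    rw [hH]
    exact le_trans (Real.log_le_self (integral_nonneg fun z => (Real.exp_pos _).le)) hZ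
  rw [e]
  linarith
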